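/- Assume GRH. Let χ mod q be a primitive Dirichlet character with q > 1, and let L(s,χ;y) = Π_{p ≤ y} (1 - χ(p)p^{-s})^{-1} denote the partial Euler product over primes up to y. Then for any ε > 0 and any complex s with Re(s) ≥ 1/2 + ε, |L(s,χ;y)| ≪_ε (q|s|)^ε. -/

import Mathlib

open Complex

/-- The Generalized Riemann Hypothesis: every zero of a Dirichlet L-function lying in the
critical strip `0 < Re(s) < 1` has real part `1/2`. -/
def GRH : Prop :=
  ∀ (N : ℕ) [NeZero N] (χ : DirichletCharacter ℂ N) (s : ℂ),
    DirichletCharacter.LFunction χ s = 0 → 0 < s.re → s.re < 1 → s.re = 1 / 2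


lemma log_branch (g : ℂ → ℂ) (hg : DifferentiableOn ℂ g {z | 1/2 < z.re})
    (h0 : ∀ z : ℂ, 1/2 < z.re → g z ≠ 0) :
    ∃ f : ℂ → ℂ, DifferentiableOn ℂ f {z | 1/2 < z.re} ∧
      ∀ z : ℂ, 1/2 < z.re → exp (f z) = g z := by
  set U : Set ℂ := {z | 1/2 < z.re} with hU
  have hUo : IsOpen U := isOpen_lt continuous_const continuous_re
  have hUc : Convex ℝ U := convex_halfSpace_re_gt _
  have hsc : IsSimplyConnected U := by
    have : ContractibleSpace U := hUc.contractibleSpace ⟨1, by simp [hU]; norm_num⟩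
    unfold IsSimplyConnected
    infer_instance
  obtain ⟨f, hfc, hfe⟩ := Complex.exists_continuousOn_eqOn_exp_comp hsc hUo hg.continuousOn
    (by rintro ⟨z, hz, h⟩; exact h0 z hz h)
  refine ⟨f, ?_, fun z hz => hfe hz⟩
  intro z hz
  have hzU : U ∈ nhds z := hUo.mem_nhds hz
  have hfz : ContinuousAt f z := hfc.continuousAt hzU
  have hgz : DifferentiableAt ℂ g z := hg.differentiableAt hzU
  have hev : f =ᶠ[nhds z] fun w => f z + log (g w / g z) := by
    have h1 : ∀ᶠ w in nhds z, ‖f w - f z‖ < 1 := by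
      have : Filter.Tendsto (fun w => ‖f w - f z‖) (nhds z) (nhds ‖f z - f z‖) :=
        (hfz.sub continuousAt_const).norm
      exact this.eventually (gt_mem_nhds (by simp))
    filter_upwards [h1, hzU] with w hw hwU
    have e1 : exp (f w) = g w := hfe hwU
    have e2 : exp (f z) = g z := hfe hz
    rw [← e1, ← e2, ← exp_sub, log_exp]
    · ring
    · have := abs_le.1 (abs_im_le_norm (f w - f z)); linarith [Real.pi_gt_three]
    · have := abs_le.1 (abs_im_le_norm (f w - f z)); linarith [Real.pi_gt_three]
  refine (DifferentiableAt.congr_of_eventuallyEq ?_ hev).differentiableWithinAt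
  refine (differentiableAt_const _).add ?_
  refine (hgz.div_const _).clog ?_
  rw [div_self (h0 z hz)]
  simp [slitPlane]

lemma char_sum_bound (q : ℕ) [NeZero q] (χ : DirichletCharacter ℂ q) (hχ : χ ≠ 1) (n : ℕ) :
    ‖∑ k ∈ Finset.range n, χ (k : ZMod q)‖ ≤ q := by
  have hq : 0 < q := NeZero.pos q
  have h0 : ∑ k ∈ Finset.range q, χ (k : ZMod q) = 0 := by
    rw [← MulChar.sum_eq_zero_of_ne_one hχ]
    refine Finset.sum_bij (fun k _ => (k : ZMod q)) (by simp) ?_ ?_ (by simp)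
    · intro a ha b hb hab
      rw [ZMod.natCast_eq_natCast_iff] at hab
      exact Nat.ModEq.eq_of_lt_of_lt hab (Finset.mem_range.1 ha) (Finset.mem_range.1 hb)
    · intro b _
      exact ⟨b.val, Finset.mem_range.2 (ZMod.val_lt b), by simp⟩
  have hk : ∀ k : ℕ, ∑ i ∈ Finset.range (q * k), χ (i : ZMod q) = 0 := by
    intro k
    induction k with
    | zero => simp
    | succ k ih =>
      rw [Nat.mul_succ, Finset.sum_range_add, ih, zero_add]
      simpa using h0
  rw [← Nat.div_add_mod n q, Finset.sum_range_add, hk, zero_add]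
  refine (norm_sum_le _ _).trans ?_
  refine (Finset.sum_le_sum (fun i _ => χ.norm_le_one _)).trans ?_
  simp
  exact (Nat.mod_lt n hq).le

lemma L_bound (q : ℕ) [NeZero q] (hq : 1 < q) (χ : DirichletCharacter ℂ q) (hχ : χ ≠ 1) (s : ℂ)
    (hs : 1/2 < s.re) : ‖DirichletCharacter.LFunction χ s‖ ≤ 2 * q * ‖s‖ := by
  set S : ℝ → ℂ := fun t => ∑ k ∈ Finset.Icc 1 ⌊t⌋₊, χ (k : ZMod q) with hS
  have hSn : ∀ n : ℕ, ‖∑ k ∈ Finset.Icc 1 n, χ (k : ZMod q)‖ ≤ q := by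
    intro n
    have := char_sum_bound q χ hχ (n+1)
    rw [Finset.range_eq_Ico, Finset.sum_eq_sum_Ico_succ_bot (by omega)] at this
    have e : χ ((0:ℕ) : ZMod q) = 0 := by
      have : Nontrivial (ZMod q) := ZMod.nontrivial_iff.2 (by omega)
      rw [Nat.cast_zero]
      exact χ.map_nonunit not_isUnit_zero
    rw [e, zero_add] at this
    exact this
  have hSb : ∀ t, ‖S t‖ ≤ q := fun t => hSn _
  have hSm : Measurable S := by
    have : S = (fun n : ℕ => ∑ k ∈ Finset.Icc 1 n, χ (k : ZMod q)) ∘ (fun t : ℝ => ⌊t⌋₊) := rfl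
    rw [this]
    exact (measurable_from_top).comp Nat.measurable_floor
  -- f
  set f : ℝ → ℂ := Set.indicator (Set.Ioi 1) S with hf
  have hfm : Measurable f := hSm.indicator measurableSet_Ioi
  have hfb : ∀ t, ‖f t‖ ≤ q := fun t => (norm_indicator_le_norm_self _ _).trans (hSb t)
  have hfl : MeasureTheory.LocallyIntegrableOn f (Set.Ioi 0) := by
    apply MeasureTheory.LocallyIntegrable.locallyIntegrableOn
    intro x
    refine ⟨Metric.ball x 1, Metric.ball_mem_nhds x one_pos, ?_⟩
    refine MeasureTheory.IntegrableOn.of_bound MeasureTheory.measure_ball_lt_top hfm.aestronglyMeasurable (q:ℝ) ?_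
    exact Filter.Eventually.of_forall hfb
  have hdiff : ∀ z : ℂ, 0 < z.re → DifferentiableAt ℂ (fun z => z * mellin f (-z)) z := by
    intro z hz
    refine differentiableAt_id.mul ?_
    have : DifferentiableAt ℂ (mellin f) (-z) := by
      refine mellin_differentiableAt_of_isBigO_rpow (a := 0) (b := -z.re - 1) hfl ?_ (by simpa using hz) ?_ (by simp)
      · refine Asymptotics.IsBigO.of_bound q (Filter.Eventually.of_forall fun t => by simpa using hfb t)
      · refine Asymptotics.IsBigO.of_bound 1 ?_
        filter_upwards [nhdsWithin_le_nhds (Iio_mem_nhds (show (0:ℝ) < 1 by norm_num))] with t ht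
        have : f t = 0 := Set.indicator_of_notMem (by simp at ht ⊢; exact ht.le) _
        rw [this]; simp
    exact this.comp z differentiableAt_id.neg
  have hint : ∀ z : ℂ, mellin f (-z) = ∫ t in Set.Ioi (1:ℝ), S t * (t:ℂ) ^ (-(z+1)) := by
    intro z
    unfold mellin
    have : ∀ t : ℝ, (t:ℂ)^(-z-1) • f t = (Set.Ioi (1:ℝ)).indicator (fun t : ℝ => S t * (t:ℂ) ^ (-(z+1))) t := by
      intro t
      by_cases ht : t ∈ Set.Ioi (1:ℝ)
      · simp only [hf, Set.indicator_of_mem ht, smul_eq_mul]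
        rw [mul_comm]; congr 2; ring
      · simp [hf, Set.indicator_of_notMem ht]
    simp_rw [this]
    rw [MeasureTheory.setIntegral_indicator measurableSet_Ioi]
    congr 2
    ext x; simp
  have heq1 : ∀ z : ℂ, 1 < z.re → DirichletCharacter.LFunction χ z = z * mellin f (-z) := by
    intro z hz
    rw [DirichletCharacter.LFunction_eq_LSeries χ hz, hint]
    rw [LSeries_eq_mul_integral _ le_rfl (by linarith) (DirichletCharacter.LSeriesSummable_of_one_lt_re χ hz)]
    refine Asymptotics.IsBigO.of_bound q (Filter.Eventually.of_forall fun n => ?_)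
    simpa using hSn n
  have hopen : IsOpen {z : ℂ | 0 < z.re} := isOpen_lt continuous_const continuous_re
  have heq : Set.EqOn (DirichletCharacter.LFunction χ) (fun z => z * mellin f (-z)) {z : ℂ | 0 < z.re} := by
    refine AnalyticOnNhd.eqOn_of_preconnected_of_eventuallyEq (𝕜 := ℂ) (z₀ := 2) ?_ ?_ ?_ ?_ ?_
    · exact (DirichletCharacter.differentiable_LFunction hχ).differentiableOn.analyticOnNhd hopen
    · exact DifferentiableOn.analyticOnNhd (fun z hz => (hdiff z hz).differentiableWithinAt) hopen
    · exact (convex_halfSpace_re_gt 0).isPreconnected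
    · simp
    · filter_upwards [(isOpen_lt continuous_const continuous_re).mem_nhds (show (2:ℂ) ∈ {z : ℂ | 1 < z.re} by simp)] with z hz
      exact heq1 z hz
  have hs0 : 0 < s.re := by linarith
  have e := heq (show s ∈ {z : ℂ | 0 < z.re} from hs0)
  rw [e]
  simp only [norm_mul]
  have hb : ‖mellin f (-s)‖ ≤ 2 * q := by
    rw [hint]
    have hi : MeasureTheory.IntegrableOn (fun t : ℝ => (q:ℝ) * t ^ (-(s.re+1))) (Set.Ioi 1) :=
      (integrableOn_Ioi_rpow_of_lt (by linarith) one_pos).const_mul _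
    refine (MeasureTheory.norm_integral_le_of_norm_le hi ?_).trans ?_
    · refine (MeasureTheory.ae_restrict_iff' measurableSet_Ioi).2 (Filter.Eventually.of_forall fun t ht => ?_)
      have ht0 : (0:ℝ) < t := lt_trans one_pos ht
      rw [norm_mul, Complex.norm_cpow_eq_rpow_re_of_pos ht0]
      simp only [neg_re, add_re, one_re]
      exact mul_le_mul_of_nonneg_right (hSb t) (by positivity)
    · rw [MeasureTheory.integral_const_mul, integral_Ioi_rpow_of_lt (by linarith) one_pos]
      simp only [Real.one_rpow]
      rw [show -(s.re+1)+1 = -s.re by ring, neg_div_neg_eq, mul_comm]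
      gcongr
      rw [div_le_iff₀ hs0]; linarith
  calc ‖s‖ * ‖mellin f (-s)‖ ≤ ‖s‖ * (2*q) := by gcongr
    _ = _ := by ring

lemma factor_norm_le {q : ℕ} (χ : DirichletCharacter ℂ q) (p : ℕ) (hp : 2 ≤ p) (z : ℂ) :
    ‖χ (p : ZMod q) * (p : ℂ) ^ (-z)‖ ≤ (p : ℝ) ^ (-z.re) := by
  rw [norm_mul, norm_natCast_cpow_of_pos (by omega), neg_re]
  have := χ.norm_le_one (p : ZMod q)
  have h2 : (0:ℝ) ≤ (p:ℝ)^(-z.re) := by positivity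
  nlinarith

lemma factor_norm_le' {q : ℕ} (χ : DirichletCharacter ℂ q) (p : ℕ) (hp : 2 ≤ p) (z : ℂ)
    (hz : 1/2 ≤ z.re) :
    ‖χ (p : ZMod q) * (p : ℂ) ^ (-z)‖ ≤ 3/4 := by
  refine (factor_norm_le χ p hp z).trans ?_
  have hp' : (2:ℝ) ≤ p := by exact_mod_cast hp
  have h1 : (p:ℝ) ^ (-z.re) ≤ (2:ℝ) ^ (-(1/2):ℝ) := by
    calc (p:ℝ) ^ (-z.re) ≤ (p:ℝ)^(-(1/2):ℝ) :=
          Real.rpow_le_rpow_of_exponent_le (by linarith) (by linarith)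
      _ ≤ _ := Real.rpow_le_rpow_of_nonpos (by norm_num) hp' (by norm_num)
  refine h1.trans ?_
  rw [Real.rpow_neg (by norm_num), ← Real.sqrt_eq_rpow]
  rw [inv_le_comm₀ (by positivity) (by norm_num)]
  apply Real.le_sqrt_of_sq_le; norm_num

lemma H_bound {q : ℕ} (χ : DirichletCharacter ℂ q) (p : ℕ) (hp : 2 ≤ p) (z : ℂ)
    (hz : 1/2 ≤ z.re) :
    ‖-log (1 - χ (p : ZMod q) * (p : ℂ) ^ (-z)) - χ (p : ZMod q) * (p : ℂ) ^ (-z)‖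
      ≤ 2 * (p : ℝ) ^ (-(2*z.re)) := by
  have h1 := factor_norm_le χ p hp z
  have h2 := factor_norm_le' χ p hp z hz
  set x := χ (p : ZMod q) * (p : ℂ) ^ (-z)
  have h3 := Complex.norm_log_one_add_sub_self_le (z := -x) (by rw [norm_neg]; linarith)
  have e : -log (1 - x) - x = -(log (1 + -x) - -x) := by ring_nf
  rw [e, norm_neg]
  refine h3.trans ?_
  rw [norm_neg]
  have h4 : (1 - ‖x‖)⁻¹ ≤ 4 := by
    rw [inv_le_comm₀ (by linarith) (by norm_num)]; linarith
  have h5 : ‖x‖^2 ≤ (p : ℝ) ^ (-(2*z.re)) := by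
    rw [show -(2*z.re) = -z.re + -z.re by ring, Real.rpow_add (by positivity), ← sq]
    gcongr
  have h6 : 0 ≤ (1 - ‖x‖)⁻¹ := inv_nonneg.2 (by linarith)
  nlinarith [sq_nonneg ‖x‖]

lemma summable_primes_rpow (r : ℝ) (hr : 1 < r) : Summable (fun p : Nat.Primes => ((p:ℕ):ℝ)^(-r)) :=
  Nat.Primes.summable_rpow.2 (by linarith)

lemma term_diff {q : ℕ} (χ : DirichletCharacter ℂ q) (p : ℕ) (hp : 2 ≤ p) :
    Differentiable ℂ (fun z : ℂ => χ (p : ZMod q) * (p : ℂ) ^ (-z)) := by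
  intro z
  refine (differentiableAt_const _).mul ?_
  refine differentiableAt_id.neg.const_cpow (Or.inl ?_)
  exact_mod_cast (by omega : p ≠ 0)

lemma exists_F (hGRH : GRH) (ε : ℝ) (hε : 0 < ε) (hε' : ε ≤ 1/2) :
    ∃ C > 0, ∀ (q : ℕ) (_ : NeZero q) (χ : DirichletCharacter ℂ q), 1 < q → χ ≠ 1 →
      ∃ F : ℂ → ℂ, DifferentiableOn ℂ F {z | 1/2 + ε/4 < z.re} ∧
        (∀ z : ℂ, 1 < z.re → F z = ∑' p : Nat.Primes, χ ((p : ℕ) : ZMod q) * ((p : ℕ) : ℂ) ^ (-z)) ∧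
        ∀ z : ℂ, 1/2 + ε/2 ≤ z.re → z.re ≤ 2 → ‖F z‖ ≤ C * Real.log (q * (|z.im| + 3)) := by
  set A : ℝ := ∑' p : Nat.Primes, 2 * ((p:ℕ):ℝ)^(-(1+ε/2)) with hA
  set B : ℝ := ∑' p : Nat.Primes, ((p:ℕ):ℝ)^(-(2:ℝ)) with hB
  have hAs : Summable (fun p : Nat.Primes => 2 * ((p:ℕ):ℝ)^(-(1+ε/2))) :=
    (summable_primes_rpow _ (by linarith)).mul_left 2
  have hBs : Summable (fun p : Nat.Primes => ((p:ℕ):ℝ)^(-(2:ℝ))) :=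
    summable_primes_rpow _ (by norm_num)
  have hA0 : 0 ≤ A := tsum_nonneg (fun p => by positivity)
  have hB0 : 0 ≤ B := tsum_nonneg (fun p => by positivity)
  refine ⟨18/ε + 6*(A+B)/ε + A, by positivity, ?_⟩
  intro q _ χ hq hχ
  have hLd := DirichletCharacter.differentiable_LFunction hχ
  have hnz : ∀ z : ℂ, 1/2 < z.re → DirichletCharacter.LFunction χ z ≠ 0 := by
    intro z hz h
    by_cases h1 : 1 ≤ z.re
    · exact DirichletCharacter.LFunction_ne_zero_of_one_le_re χ (Or.inl hχ) h1 h
    · have := hGRH q χ z h (by linarith) (by linarith)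
      linarith
  obtain ⟨Lg, hLgd, hLge⟩ := log_branch _ hLd.differentiableOn hnz
  set x : Nat.Primes → ℂ → ℂ := fun p z => χ ((p : ℕ) : ZMod q) * ((p : ℕ) : ℂ) ^ (-z) with hx
  set Hp : Nat.Primes → ℂ → ℂ := fun p z => -log (1 - x p z) - x p z with hHp
  set H : ℂ → ℂ := fun z => ∑' p, Hp p z with hH
  have hp2 : ∀ p : Nat.Primes, 2 ≤ (p:ℕ) := fun p => p.2.two_le
  have hHb : ∀ z : ℂ, 1/2+ε/4 ≤ z.re → ∀ p, ‖Hp p z‖ ≤ 2 * ((p:ℕ):ℝ)^(-(1+ε/2)) := by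
    intro z hz p
    refine (H_bound χ p (hp2 p) z (by linarith)).trans ?_
    have : (1:ℝ) ≤ (p:ℕ) := by exact_mod_cast (by linarith [hp2 p])
    gcongr
    linarith
  have hHn : ∀ z : ℂ, 1/2+ε/4 ≤ z.re → ‖H z‖ ≤ A := fun z hz =>
    tsum_of_norm_bounded hAs.hasSum (hHb z hz)
  have hHpd : ∀ p, ∀ z : ℂ, 1/2 < z.re → DifferentiableAt ℂ (Hp p) z := by
    intro p z hz
    have hxd : DifferentiableAt ℂ (x p) z := term_diff χ p (hp2 p) z
    refine DifferentiableAt.sub (DifferentiableAt.neg (DifferentiableAt.clog (hxd.const_sub 1) ?_)) hxd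
    left
    have := factor_norm_le' χ p (hp2 p) z hz.le
    have h2 := (abs_le.1 (abs_re_le_norm (x p z))).2
    simp only [sub_re, one_re]
    have h3 : ‖x p z‖ ≤ 3/4 := this
    linarith
  have hop : ∀ r : ℝ, IsOpen {z : ℂ | r < z.re} := fun r => isOpen_lt continuous_const continuous_re
  have hHd : DifferentiableOn ℂ H {z | 1/2 + ε/4 < z.re} :=
    differentiableOn_tsum_of_summable_norm hAs
      (fun p z hz => (hHpd p z (by simp at hz ⊢; linarith)).differentiableWithinAt) (hop _)
      (fun p z hz => hHb z (le_of_lt hz) p)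
  set P : ℂ → ℂ := fun z => ∑' p, x p z with hP
  have hPd : ∀ z : ℂ, 1 < z.re → DifferentiableAt ℂ P z := by
    intro z hz
    set r := (1 + z.re)/2
    have hr : 1 < r := by simp only [r]; linarith
    have hr2 : r < z.re := by simp only [r]; linarith
    have : DifferentiableOn ℂ P {z | r < z.re} := by
      refine differentiableOn_tsum_of_summable_norm (summable_primes_rpow r hr)
        (fun p z hz => (term_diff χ p (hp2 p) z).differentiableWithinAt) (hop _) ?_
      intro p w hw
      refine (factor_norm_le χ p (hp2 p) w).trans ?_
      have : (1:ℝ) ≤ (p:ℕ) := by exact_mod_cast (by linarith [hp2 p])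
      apply Real.rpow_le_rpow_of_exponent_le this
      have : r < w.re := hw
      linarith
    exact this.differentiableAt ((hop r).mem_nhds hr2)
  have hxs : ∀ z : ℂ, 1 < z.re → Summable (fun p => x p z) := fun z hz =>
    Summable.of_norm_bounded (summable_primes_rpow _ hz) (fun p => factor_norm_le χ p (hp2 p) z)
  have hE : ∀ z : ℂ, 1 < z.re → exp (P z + H z) = DirichletCharacter.LFunction χ z := by
    intro z hz
    rw [DirichletCharacter.LFunction_eq_LSeries χ hz, ← DirichletCharacter.LSeries_eulerProduct_exp_log χ hz]
    congr 1
    have hHs : Summable (fun p => Hp p z) := Summable.of_norm_bounded hAs (hHb z (by linarith))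
    simp only [hP, hH]
    rw [← (hxs z hz).tsum_add hHs]
    congr 1
    ext p
    simp [hHp, hx]
  set c := Lg 2 - (P 2 + H 2) with hc
  have hcE : exp c = 1 := by
    rw [hc, exp_sub, hLge 2 (by norm_num), hE 2 (by norm_num), div_self (hnz 2 (by norm_num))]
  have hconst : ∀ z : ℂ, 1 < z.re → Lg z - (P z + H z) = c := by
    have hd : ∀ z : ℂ, 1 < z.re → DifferentiableAt ℂ (fun z => Lg z - (P z + H z)) z := by
      intro z hz
      refine DifferentiableAt.sub ?_ (DifferentiableAt.add (hPd z hz) ?_)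
      · exact hLgd.differentiableAt ((hop _).mem_nhds (by simp; linarith))
      · exact hHd.differentiableAt ((hop _).mem_nhds (by simp; linarith))
    intro z hz
    refine (hop 1).is_const_of_deriv_eq_zero (𝕜 := ℂ) (f := fun z => Lg z - (P z + H z))
      (convex_halfSpace_re_gt 1).isPreconnected
      (fun z hz => (hd z hz).differentiableWithinAt) ?_ hz (show (1:ℝ) < (2:ℂ).re by norm_num)
    intro w hw
    have e1 : (fun z => exp (Lg z - (P z + H z))) =ᶠ[nhds w] fun _ => 1 := by
      filter_upwards [(hop 1).mem_nhds hw] with v hv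
      have hv : 1 < v.re := hv
      rw [exp_sub, hLge v (by linarith), hE v hv, div_self (hnz v (by linarith))]
    have h1 := (hd w hw).hasDerivAt.cexp
    have h2 := h1.deriv
    rw [e1.deriv_eq, deriv_const] at h2
    have h3 := mul_eq_zero.1 h2.symm
    exact h3.resolve_left (exp_ne_zero _)
  refine ⟨fun z => Lg z - c - H z, ?_, ?_, ?_⟩
  · refine DifferentiableOn.sub (DifferentiableOn.sub (hLgd.mono ?_) (differentiableOn_const _)) hHd
    intro z hz; simp at hz ⊢; linarith
  · intro z hz
    have := hconst z hz
    rw [← this]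
    simp only [hP, hx]
    ring
  · intro z hz1 hz2
    have hH1 := hHn z (by linarith)
    set t := z.im
    set z0 : ℂ := 2 + t * I with hz0
    set f : ℂ → ℂ := fun u => Lg (z0 + u) - c with hf
    set M := Real.log (2 * q * (|t| + 5)) with hM
    have hq' : (2:ℝ) ≤ q := by exact_mod_cast hq
    have ht0 := abs_nonneg t
    have hM0 : 0 < M := Real.log_pos (by nlinarith)
    have hball : ∀ u ∈ Metric.ball (0:ℂ) (3/2), 1/2 < (z0 + u).re := by
      intro u hu
      have h1 : ‖u‖ < 3/2 := by simpa using hu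
      have := (abs_le.1 (abs_re_le_norm u)).1
      simp [hz0]; linarith
    have hfd : DifferentiableOn ℂ f (Metric.ball 0 (3/2)) := by
      refine DifferentiableOn.sub ?_ (differentiableOn_const _)
      exact hLgd.comp (by fun_prop) hball
    have hfm : Set.MapsTo f (Metric.ball 0 (3/2)) {z | z.re ≤ M} := by
      intro u hu
      have h1 := hball u hu
      have hu' : ‖u‖ < 3/2 := by simpa using hu
      have h2 := L_bound q hq χ hχ _ h1
      have h3 : exp (f u) = DirichletCharacter.LFunction χ (z0+u) := by
        simp only [hf]; rw [exp_sub, hcE, hLge _ h1, div_one]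
      rw [← h3, norm_exp] at h2
      have h4 : ‖z0 + u‖ ≤ |t| + 5 := by
        have e1 : ‖z0‖ ≤ 2 + |t| := by
          refine (norm_add_le _ _).trans ?_
          simp
        linarith [norm_add_le z0 u]
      simp only [Set.mem_ofPred_eq]
      rw [hM, Real.le_log_iff_exp_le (by positivity)]
      refine h2.trans ?_
      gcongr
    have hzb : z - z0 ∈ Metric.ball (0:ℂ) (3/2) ∧ ‖z - z0‖ ≤ 3/2 - ε/2 := by
      have e : z - z0 = ((z.re - 2 : ℝ) : ℂ) := by
        apply Complex.ext <;> simp [hz0, t]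
      have e2 : ‖z - z0‖ ≤ 3/2 - ε/2 := by
        rw [e, Complex.norm_real, Real.norm_eq_abs, abs_le]
        constructor <;> linarith
      exact ⟨by simp; linarith, e2⟩
    have hBC := Complex.borelCaratheodory hM0 hfd hfm (by norm_num) hzb.1
    have hfz : f (z - z0) = Lg z - c := by simp [hf]
    have hf0 : ‖f 0‖ ≤ A + B := by
      have hz01 : 1 < z0.re := by simp [hz0]
      have e : f 0 = P z0 + H z0 := by
        simp only [hf, add_zero]; rw [← hconst z0 hz01]; ring
      rw [e]
      have h1 : ‖P z0‖ ≤ B := by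
        refine tsum_of_norm_bounded hBs.hasSum (fun p => ?_)
        refine (factor_norm_le χ p (hp2 p) z0).trans (le_of_eq ?_)
        simp [hz0]
      have h2 := hHn z0 (by simp [hz0]; linarith)
      linarith [norm_add_le (P z0) (H z0)]
    rw [hfz] at hBC
    set Lq := Real.log (q * (|t|+3)) with hLq
    have hLq1 : 1 ≤ Lq := by
      rw [hLq, Real.le_log_iff_exp_le (by positivity)]
      have := Real.exp_one_lt_d9
      nlinarith
    have hMq : M ≤ 3 * Lq := by
      have h1 : M ≤ Real.log (4 * (q * (|t|+3))) := by
        apply Real.log_le_log (by positivity)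
        nlinarith
      rw [Real.log_mul (by norm_num) (by positivity)] at h1
      have h2 : Real.log 4 ≤ 2 := by
        rw [show (4:ℝ) = 2^2 by norm_num, Real.log_pow]
        have := Real.log_two_lt_d9
        push_cast; linarith
      linarith
    have hr := hzb.2
    have hn0 := norm_nonneg (z - z0)
    have hbd : ‖Lg z - c‖ ≤ (18/ε) * Lq + 6*(A+B)/ε := by
      refine hBC.trans (add_le_add ?_ ?_)
      · rw [div_le_iff₀ (by linarith)]
        have : 18/ε * Lq * (ε/2) = 9 * Lq := by field_simp; ring
        have h2 : 18/ε * Lq * (ε/2) ≤ 18/ε * Lq * (3/2 - ‖z - z0‖) := by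
          gcongr; linarith
        nlinarith
      · rw [div_le_iff₀ (by linarith)]
        have : 6*(A+B)/ε * (ε/2) = 3 * (A+B) := by field_simp; ring
        have h2 : 6*(A+B)/ε * (ε/2) ≤ 6*(A+B)/ε * (3/2 - ‖z - z0‖) := by
          gcongr; linarith
        nlinarith [norm_nonneg (f 0)]
    have h1 : ‖Lg z - c - H z‖ ≤ (18/ε) * Lq + 6*(A+B)/ε + A := by
      linarith [norm_sub_le (Lg z - c) (H z)]
    have h2 : 0 ≤ 6*(A+B)/ε + A := by positivity
    show ‖Lg z - c - H z‖ ≤ _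
    nlinarith


lemma norm_lower (w : ℂ) (m : ℝ) (hm : 0 < m) (hm1 : m ≤ 1) (h : m ≤ |w.re|) :
    m / 2 * (1 + |w.im|) ≤ ‖w‖ := by
  have h1 := abs_re_le_norm w
  have h2 := abs_im_le_norm w
  have h3 := abs_nonneg w.im
  rcases le_total |w.im| 1 with h4 | h4 <;> nlinarith

lemma integrable_decay (r : ℝ) (hr : 1 < r) :
    MeasureTheory.Integrable (fun v : ℝ => (1 + |v|)^(-r)) := by
  have := integrable_one_add_norm (E := ℝ) (μ := MeasureTheory.volume) (r := r) (by simpa using hr)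
  simpa using this

lemma inv_prod_bound' (w : ℂ) (m : ℝ) (hm : 0 < m)
    (h : m / 2 * (1 + |w.im|) ≤ ‖w‖) (h' : m / 2 * (1 + |w.im|) ≤ ‖w + 1‖) :
    1 / (‖w‖ * ‖w + 1‖) ≤ (2/m)^2 * (1 + |w.im|)^(-(2:ℝ)) := by
  have h3 := abs_nonneg w.im
  have hp : 0 < m / 2 * (1 + |w.im|) := by positivity
  rw [Real.rpow_neg (by positivity), Real.rpow_two]
  have e : (2/m)^2 * ((1 + |w.im|)^2)⁻¹ = 1 / ((m / 2 * (1 + |w.im|)) * (m / 2 * (1 + |w.im|))) := by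
    field_simp
  rw [e]
  gcongr

lemma inv_prod_bound (w : ℂ) (m : ℝ) (hm : 0 < m) (hm1 : m ≤ 1) (h : m ≤ |w.re|)
    (h' : m ≤ |(w + 1).re|) :
    1 / (‖w‖ * ‖w + 1‖) ≤ (2/m)^2 * (1 + |w.im|)^(-(2:ℝ)) := by
  refine inv_prod_bound' w m hm (norm_lower w m hm hm1 h) ?_
  have := norm_lower (w+1) m hm hm1 h'
  simpa using this

lemma perron1 (c u : ℝ) (hc : 0 < c) (hu : 0 < u) :
    ∫ v : ℝ, (u : ℂ) ^ (-((c:ℂ) + v * I)) * (1 / (((c:ℂ) + v * I) * ((c:ℂ) + v * I + 1)))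
      = 2 * Real.pi * ((max 0 (1 - u) : ℝ) : ℂ) := by
  set f : ℝ → ℂ := fun t => Set.indicator (Set.Ioc 0 1) (fun _ => 1 : ℝ → ℂ) t -
    Set.indicator (Set.Ioc 0 1) (fun t => (t:ℂ) ^ (1:ℂ) : ℝ → ℂ) t with hf
  have hfeq : ∀ t : ℝ, 0 < t → f t = ((max 0 (1 - t) : ℝ) : ℂ) := by
    intro t ht
    by_cases h1 : t ≤ 1
    · have : t ∈ Set.Ioc (0:ℝ) 1 := ⟨ht, h1⟩
      simp only [hf, Set.indicator_of_mem this]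
      rw [max_eq_right (by linarith)]; simp
    · have : t ∉ Set.Ioc (0:ℝ) 1 := fun h => h1 h.2
      simp only [hf, Set.indicator_of_notMem this]
      rw [max_eq_left (by linarith)]; simp
  have hM : ∀ w : ℂ, 0 < w.re → HasMellin f w (1 / (w * (w + 1))) := by
    intro w hw
    have h1 := hasMellin_one_Ioc hw
    have h2 := hasMellin_cpow_Ioc 1 (s := w) (by simp; linarith)
    have h3 := hasMellin_sub h1.1 h2.1
    rw [h1.2, h2.2] at h3
    have hw0 : w ≠ 0 := by rintro rfl; simp at hw
    have hw1 : w + 1 ≠ 0 := by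
      intro h; have := congrArg Complex.re h; simp at this; linarith
    have e : 1 / (w * (w + 1)) = 1 / w - 1 / (w + 1) := by field_simp; ring
    rw [e]; exact h3
  have hmel : ∀ v : ℝ, mellin f ((c:ℂ) + v * I) = 1 / (((c:ℂ) + v * I) * ((c:ℂ) + v * I + 1)) :=
    fun v => (hM _ (by simpa using hc)).2
  have hne0 : ∀ v : ℝ, (c:ℂ) + v * I ≠ 0 := by
    intro v h; have := congrArg Complex.re h; simp at this; linarith
  have hne1 : ∀ v : ℝ, (c:ℂ) + v * I + 1 ≠ 0 := by
    intro v h; have := congrArg Complex.re h; simp at this; linarith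
  have hvert : VerticalIntegrable (mellin f) c := by
    unfold VerticalIntegrable
    simp_rw [hmel]
    have hdom : MeasureTheory.Integrable (fun v : ℝ => (2 / min c 1)^2 * (1 + |v|)^(-(2:ℝ))) :=
      (integrable_decay 2 (by norm_num)).const_mul _
    refine hdom.mono' ?_ (Filter.Eventually.of_forall fun v => ?_)
    · refine Continuous.aestronglyMeasurable ?_
      refine continuous_const.div (by fun_prop) (fun v => mul_ne_zero (hne0 v) (hne1 v))
    · rw [norm_div, norm_one]
      have := inv_prod_bound ((c:ℂ) + v * I) (min c 1) (lt_min hc one_pos) (min_le_right _ _)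
        (by simp; left; exact le_abs_self c)
        (by simp; left; exact le_trans (by linarith) (le_abs_self (c+1)))
      simpa [norm_mul] using this
  have := mellinInv_mellin_eq c f hu (hM c (by simpa using hc)).1 hvert ?_
  · rw [hfeq u hu] at this
    rw [← this, mellinInv]
    simp_rw [hmel]
    simp only [smul_eq_mul, real_smul]
    push_cast
    have hpi : (Real.pi : ℂ) ≠ 0 := by exact_mod_cast Real.pi_ne_zero
    rw [← mul_assoc, mul_one_div_cancel (by simpa using hpi), one_mul]
  · have : ContinuousAt (fun t : ℝ => ((max 0 (1 - t) : ℝ) : ℂ)) u := by fun_prop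
    refine this.congr ?_
    filter_upwards [lt_mem_nhds hu] with t ht
    exact (hfeq t ht).symm

noncomputable def Kern (y h : ℝ) (w : ℂ) : ℂ :=
  (((y + h : ℝ) : ℂ) ^ (w + 1) - (y : ℂ) ^ (w + 1)) / (h * w * (w + 1))

lemma kern_crude (y h : ℝ) (hy : 1 ≤ y) (hh : 0 < h) (w : ℂ) (hw : w.re ≤ 2) :
    ‖Kern y h w‖ ≤ (2 * (y + h) ^ (3:ℝ) / h) / (‖w‖ * ‖w + 1‖) := by
  unfold Kern
  rw [norm_div, norm_mul, norm_mul, Complex.norm_real, Real.norm_eq_abs, abs_of_pos hh,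
    mul_assoc, ← div_div]
  gcongr
  refine (norm_sub_le _ _).trans ?_
  rw [Complex.norm_cpow_eq_rpow_re_of_pos (by linarith), Complex.norm_cpow_eq_rpow_re_of_pos (by linarith)]
  have h1 : (y+h) ^ (w+1).re ≤ (y+h)^(3:ℝ) :=
    Real.rpow_le_rpow_of_exponent_le (by linarith) (by simp; linarith)
  have h2 : y ^ (w+1).re ≤ (y+h)^(3:ℝ) :=
    (Real.rpow_le_rpow_of_exponent_le (by linarith) (by simp; linarith)).trans
      (Real.rpow_le_rpow (by linarith) (by linarith : y ≤ y + h) (by norm_num : (0:ℝ) ≤ 3))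
  linarith

lemma kern_left (y h θ : ℝ) (hy : 1 ≤ y) (hh : 0 < h) (hhy : h ≤ y) (hθ : 0 < θ) (hθ1 : θ < 1)
    (w : ℂ) (hw0 : w.re < 0) (hw1 : -1 < w.re) :
    ‖Kern y h w‖ ≤ 4 * y ^ w.re * (y / h) ^ θ * (‖w‖⁻¹ * ‖w + 1‖ ^ (-θ)) := by
  have hy0 : 0 < y := by linarith
  have hwp : 0 < ‖w‖ := by
    rw [norm_pos_iff]; rintro rfl; simp at hw0
  have hw1p : 0 < ‖w + 1‖ := by
    rw [norm_pos_iff]; intro h; have := congrArg Complex.re h; simp at this; linarith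
  have hw1n : w + 1 ≠ 0 := norm_pos_iff.1 hw1p
  set N := ‖((y + h : ℝ) : ℂ) ^ (w + 1) - (y : ℂ) ^ (w + 1)‖ with hN
  have hN0 : 0 ≤ N := norm_nonneg _
  have hA1 : N ≤ ‖w + 1‖ * h * y ^ w.re := by
    have hder : ∀ x ∈ Set.Icc y (y+h), HasDerivWithinAt (fun x : ℝ => (x:ℂ)^(w+1)) ((w+1) * (x:ℂ)^w)
        (Set.Icc y (y+h)) x := by
      intro x hx
      have hx0 : x ≠ 0 := by linarith [hx.1]
      have := (hasDerivAt_ofReal_cpow_const' hx0 (r := w) (by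
        intro h; rw [h] at hw1; simp at hw1)).const_mul (w+1)
      refine (this.congr_of_eventuallyEq ?_).hasDerivWithinAt
      filter_upwards with t
      field_simp
    have := Convex.norm_image_sub_le_of_norm_hasDerivWithin_le (C := ‖w+1‖ * y ^ w.re) hder (fun x hx => ?_)
      (convex_Icc _ _) (Set.left_mem_Icc.2 (by linarith)) (Set.right_mem_Icc.2 (by linarith))
    · simp only [add_sub_cancel_left, Real.norm_eq_abs, abs_of_pos hh] at this
      refine this.trans (le_of_eq (by ring))
    · rw [norm_mul, Complex.norm_cpow_eq_rpow_re_of_pos (by linarith [hx.1])]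
      refine mul_le_mul_of_nonneg_left ?_ (norm_nonneg _)
      exact Real.rpow_le_rpow_of_nonpos hy0 hx.1 hw0.le
  have hA2 : N ≤ 4 * y ^ (w.re + 1) := by
    refine (norm_sub_le _ _).trans ?_
    rw [Complex.norm_cpow_eq_rpow_re_of_pos (by linarith), Complex.norm_cpow_eq_rpow_re_of_pos (by linarith)]
    simp only [add_re, one_re]
    have h1 : (y+h)^(w.re+1) ≤ 2 * y^(w.re+1) := by
      calc (y+h)^(w.re+1) ≤ (2*y)^(w.re+1) := by gcongr <;> linarith
        _ = 2^(w.re+1) * y^(w.re+1) := Real.mul_rpow (by norm_num) hy0.le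
        _ ≤ 2 ^ (1:ℝ) * y^(w.re+1) := by
          gcongr
          · norm_num
          · linarith
        _ = _ := by rw [Real.rpow_one]
    have : 0 ≤ y^(w.re+1) := by positivity
    linarith
  have hNN : N ≤ (‖w + 1‖ * h * y ^ w.re)^(1-θ) * (4 * y ^ (w.re + 1))^θ := by
    rcases hN0.eq_or_lt with h0 | h0
    · rw [← h0]; positivity
    calc N = N^(1-θ) * N^θ := by rw [← Real.rpow_add h0]; simp
      _ ≤ _ := by gcongr
  have e : ‖Kern y h w‖ = N / (h * ‖w‖ * ‖w+1‖) := by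
    unfold Kern
    rw [norm_div, norm_mul, norm_mul, Complex.norm_real, Real.norm_eq_abs, abs_of_pos hh]
  rw [e, div_le_iff₀ (by positivity)]
  refine hNN.trans ?_
  have hyr : 0 < y ^ w.re := by positivity
  rw [Real.rpow_add hy0, Real.rpow_one, Real.mul_rpow (by positivity) hyr.le,
    Real.mul_rpow hw1p.le hh.le, Real.mul_rpow (by norm_num) (by positivity), Real.mul_rpow hyr.le hy0.le,
    Real.div_rpow hy0.le hh.le, Real.rpow_sub hw1p, Real.rpow_sub hh, Real.rpow_sub hyr, Real.rpow_neg hw1p.le]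
  simp only [Real.rpow_one]
  have h4 : (4:ℝ)^θ ≤ 4 := by
    calc (4:ℝ)^θ ≤ 4^(1:ℝ) := Real.rpow_le_rpow_of_exponent_le (by norm_num) hθ1.le
      _ = 4 := Real.rpow_one _
  have hpos1 : 0 < ‖w+1‖^θ := by positivity
  have hpos2 : 0 < h^θ := by positivity
  have hpos3 : 0 < (y ^ w.re)^θ := by positivity
  have hpos4 : 0 < y^θ := by positivity
  have e2 : ‖w + 1‖ / ‖w + 1‖ ^ θ * (h / h ^ θ) * (y ^ w.re / (y ^ w.re) ^ θ) * (4 ^ θ * ((y ^ w.re) ^ θ * y ^ θ))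
     = 4^θ * (‖w + 1‖ / ‖w + 1‖ ^ θ * (h / h ^ θ) * y ^ w.re * y ^ θ) := by
    field_simp
  have e3 : 4 * y ^ w.re * (y ^ θ / h ^ θ) * (‖w‖⁻¹ * (‖w + 1‖ ^ θ)⁻¹) * (h * ‖w‖ * ‖w + 1‖)
     = 4 * (‖w + 1‖ / ‖w + 1‖ ^ θ * (h / h ^ θ) * y ^ w.re * y ^ θ) := by
    field_simp
  rw [e2, e3]
  gcongr

lemma contour_shift (f : ℂ → ℂ) (a b : ℝ) (hab : a ≤ b) (r D : ℝ) (hr : 0 < r)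
    (hd : DifferentiableOn ℂ f {z | a ≤ z.re ∧ z.re ≤ b})
    (hbd : ∀ z : ℂ, a ≤ z.re → z.re ≤ b → 1 ≤ |z.im| → ‖f z‖ ≤ D * (1 + |z.im|) ^ (-r))
    (hia : MeasureTheory.Integrable (fun v : ℝ => f (a + v * I)))
    (hib : MeasureTheory.Integrable (fun v : ℝ => f (b + v * I))) :
    ∫ v : ℝ, f (a + v * I) = ∫ v : ℝ, f (b + v * I) := by
  have hrect : ∀ T : ℝ, (∫ x : ℝ in a..b, f (x + (-T : ℝ) * I)) - (∫ x : ℝ in a..b, f (x + T * I)) +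
      I * (∫ y : ℝ in (-T)..T, f (b + y * I)) - I * (∫ y : ℝ in (-T)..T, f (a + y * I)) = 0 := by
    intro T
    have := integral_boundary_rect_eq_zero_of_differentiableOn f (a + (-T:ℝ) * I) (b + T * I) (hd.mono ?_)
    · simpa using this
    · intro z hz
      have h1 := hz.1
      simp [Set.uIcc_of_le hab] at h1
      exact h1
  have hz : ∀ σ : ℝ → ℝ, (∀ T, |σ T| = |T|) → Filter.Tendsto (fun T : ℝ => ∫ x : ℝ in a..b, f (x + (σ T) * I))
      Filter.atTop (nhds 0) := by
    intro σ hσ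
    have hlim : Filter.Tendsto (fun T : ℝ => D * (1 + T)^(-r) * |b - a|) Filter.atTop (nhds 0) := by
      have h1 : Filter.Tendsto (fun T : ℝ => (1 + T)^(-r)) Filter.atTop (nhds 0) :=
        (tendsto_rpow_neg_atTop hr).comp (Filter.tendsto_atTop_add_const_left _ 1 Filter.tendsto_id)
      simpa using (h1.const_mul D).mul_const (|b-a|)
    refine squeeze_zero_norm' ?_ hlim
    filter_upwards [Filter.eventually_ge_atTop 1] with T hT
    refine intervalIntegral.norm_integral_le_of_norm_le_const (fun x hx => ?_)
    rw [Set.uIoc_of_le hab] at hx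
    have e : ((x:ℂ) + (σ T) * I).im = σ T := by simp
    have e2 : ((x:ℂ) + (σ T) * I).re = x := by simp
    have := hbd (x + (σ T) * I) (by rw [e2]; exact hx.1.le) (by rw [e2]; exact hx.2) (by
      rw [e, hσ]; exact hT.trans (le_abs_self T))
    rwa [e, hσ, abs_of_pos (by linarith)] at this
  have hA := MeasureTheory.intervalIntegral_tendsto_integral hia Filter.tendsto_neg_atTop_atBot Filter.tendsto_id
  have hB := MeasureTheory.intervalIntegral_tendsto_integral hib Filter.tendsto_neg_atTop_atBot Filter.tendsto_id
  have h1 := hz (fun T => -T) (fun T => abs_neg T)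
  have h2 := hz (fun T => T) (fun T => rfl)
  have hlim := ((h1.sub h2).add (hB.const_mul I)).sub (hA.const_mul I)
  have h0 : Filter.Tendsto (fun _ : ℝ => (0:ℂ)) Filter.atTop (nhds (0 - 0 + I * (∫ v : ℝ, f (b + v * I)) - I * (∫ v : ℝ, f (a + v * I)))) := by
    refine hlim.congr (fun T => ?_)
    exact hrect T
  have := tendsto_nhds_unique h0 tendsto_const_nhds
  have h3 : I * ((∫ v : ℝ, f (b + v * I)) - (∫ v : ℝ, f (a + v * I))) = 0 := by
    rw [← this]; ring
  have h4 := (mul_eq_zero.1 h3).resolve_left I_ne_zero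
  exact (sub_eq_zero.1 h4).symm


lemma perron1_int (c u : ℝ) (hc : 0 < c) (hu : 0 < u) :
    MeasureTheory.Integrable (fun v : ℝ => (u : ℂ) ^ (-((c:ℂ) + v * I)) *
      (1 / (((c:ℂ) + v * I) * ((c:ℂ) + v * I + 1)))) := by
  have hne0 : ∀ v : ℝ, (c:ℂ) + v * I ≠ 0 := by
    intro v h; have := congrArg Complex.re h; simp at this; linarith
  have hne1 : ∀ v : ℝ, (c:ℂ) + v * I + 1 ≠ 0 := by
    intro v h; have := congrArg Complex.re h; simp at this; linarith
  have hdom : MeasureTheory.Integrable (fun v : ℝ => u^(-c) * ((2 / min c 1)^2 * (1 + |v|)^(-(2:ℝ)))) :=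
    ((integrable_decay 2 (by norm_num)).const_mul _).const_mul _
  refine hdom.mono' ?_ (Filter.Eventually.of_forall fun v => ?_)
  · refine Continuous.aestronglyMeasurable ?_
    refine Continuous.mul ?_ (continuous_const.div (by fun_prop) (fun v => mul_ne_zero (hne0 v) (hne1 v)))
    refine Continuous.const_cpow (by fun_prop) (Or.inl ?_)
    exact_mod_cast hu.ne'
  · rw [norm_mul, Complex.norm_cpow_eq_rpow_re_of_pos hu, norm_div, norm_one]
    have := inv_prod_bound ((c:ℂ) + v * I) (min c 1) (lt_min hc one_pos) (min_le_right _ _)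
      (by simp; left; exact le_abs_self c)
      (by simp; left; exact le_trans (by linarith) (le_abs_self (c+1)))
    have e : (-((c:ℂ) + v * I)).re = -c := by simp
    rw [e]
    refine mul_le_mul_of_nonneg_left ?_ (by positivity)
    simpa [norm_mul] using this

lemma cpow_scale (x n : ℝ) (hx : 0 < x) (hn : 0 < n) (w : ℂ) :
    (x : ℂ) * ((n / x : ℝ) : ℂ) ^ (-w) = (n : ℂ) ^ (-w) * (x : ℂ) ^ (w + 1) := by
  have hxc : (x : ℂ) ≠ 0 := by exact_mod_cast hx.ne'
  have h1 : (n : ℂ) ^ (-w) = ((n / x : ℝ) : ℂ) ^ (-w) * (x : ℂ) ^ (-w) := by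
    rw [← mul_cpow_ofReal_nonneg (by positivity) hx.le]
    congr 1
    push_cast
    field_simp
  rw [h1, mul_assoc, ← cpow_add _ _ hxc]
  simp [mul_comm]

lemma perronK (c y h n : ℝ) (hc : 0 < c) (hy : 0 < y) (hh : 0 < h) (hn : 0 < n) :
    ∫ v : ℝ, (n : ℂ) ^ (-((c:ℂ) + v * I)) * Kern y h ((c:ℂ) + v * I)
      = 2 * Real.pi * (((max 0 (y + h - n) - max 0 (y - n)) / h : ℝ) : ℂ) := by
  have hyh : 0 < y + h := by linarith
  have hhc : (h : ℂ) ≠ 0 := by exact_mod_cast hh.ne'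
  have e : ∀ v : ℝ, (n : ℂ) ^ (-((c:ℂ) + v * I)) * Kern y h ((c:ℂ) + v * I)
      = (((y + h)/h : ℝ) : ℂ) * (((n / (y+h) : ℝ) : ℂ) ^ (-((c:ℂ) + v * I)) *
          (1 / (((c:ℂ) + v * I) * ((c:ℂ) + v * I + 1))))
        - ((y/h : ℝ) : ℂ) * (((n / y : ℝ) : ℂ) ^ (-((c:ℂ) + v * I)) *
          (1 / (((c:ℂ) + v * I) * ((c:ℂ) + v * I + 1)))) := by
    intro v
    have hne0 : (c:ℂ) + v * I ≠ 0 := by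
      intro h; have := congrArg Complex.re h; simp at this; linarith
    have hne1 : (c:ℂ) + v * I + 1 ≠ 0 := by
      intro h; have := congrArg Complex.re h; simp at this; linarith
    have e1 := cpow_scale (y+h) n hyh hn ((c:ℂ) + v * I)
    have e2 := cpow_scale y n hy hn ((c:ℂ) + v * I)
    set w := (c:ℂ) + v * I
    unfold Kern
    rw [ofReal_div (y+h) h, ofReal_div y h]
    calc (n : ℂ) ^ (-w) * ((((y + h : ℝ) : ℂ) ^ (w + 1) - (y : ℂ) ^ (w + 1)) / (h * w * (w + 1)))
        = ((n : ℂ) ^ (-w) * ((y + h : ℝ) : ℂ) ^ (w + 1) - (n : ℂ) ^ (-w) * (y : ℂ) ^ (w + 1))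
          / (h * w * (w + 1)) := by ring
      _ = _ := by
        rw [← e1, ← e2]
        field_simp
  simp_rw [e]
  rw [MeasureTheory.integral_sub ((perron1_int c _ hc (by positivity)).const_mul _)
    ((perron1_int c _ hc (by positivity)).const_mul _), MeasureTheory.integral_const_mul,
    MeasureTheory.integral_const_mul, perron1 c _ hc (by positivity), perron1 c _ hc (by positivity)]
  have m : ∀ x : ℝ, 0 < x → x * max 0 (1 - n / x) = max 0 (x - n) := by
    intro x hx
    rw [mul_max_of_nonneg _ _ hx.le]
    congr 1
    · simp
    · field_simp
  rw [← m (y+h) hyh, ← m y hy]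
  push_cast
  field_simp

lemma kern_int (c y h : ℝ) (hc : 0 < c) (hc2 : c ≤ 2) (hy : 1 ≤ y) (hh : 0 < h) :
    MeasureTheory.Integrable (fun v : ℝ => Kern y h ((c:ℂ) + v * I)) := by
  have hdom : MeasureTheory.Integrable (fun v : ℝ => (2 * (y + h) ^ (3:ℝ) / h) * ((2 / min c 1)^2 * (1 + |v|)^(-(2:ℝ)))) :=
    ((integrable_decay 2 (by norm_num)).const_mul _).const_mul _
  have hne0 : ∀ v : ℝ, (c:ℂ) + v * I ≠ 0 := by
    intro v h; have := congrArg Complex.re h; simp at this; linarith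
  have hne1 : ∀ v : ℝ, (c:ℂ) + v * I + 1 ≠ 0 := by
    intro v h; have := congrArg Complex.re h; simp at this; linarith
  have hhc : (h : ℂ) ≠ 0 := by exact_mod_cast hh.ne'
  refine hdom.mono' ?_ (Filter.Eventually.of_forall fun v => ?_)
  · refine Continuous.aestronglyMeasurable ?_
    unfold Kern
    refine Continuous.div ?_ (by fun_prop) (fun v => mul_ne_zero (mul_ne_zero hhc (hne0 v)) (hne1 v))
    refine Continuous.sub ?_ ?_
    · refine Continuous.const_cpow (by fun_prop) (Or.inl ?_)
      exact_mod_cast (by linarith : y + h ≠ 0)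
    · refine Continuous.const_cpow (by fun_prop) (Or.inl ?_)
      exact_mod_cast (by linarith : y ≠ 0)
  · refine (kern_crude y h hy hh _ (by simpa using hc2)).trans ?_
    rw [div_eq_mul_one_div]
    refine mul_le_mul_of_nonneg_left ?_ (by positivity)
    have := inv_prod_bound ((c:ℂ) + v * I) (min c 1) (lt_min hc one_pos) (min_le_right _ _)
      (by simp; left; exact le_abs_self c)
      (by simp; left; exact le_trans (by linarith) (le_abs_self (c+1)))
    simpa [norm_mul] using this

lemma smooth_sum (a : ℕ → ℂ) (ha : ∀ n, ‖a n‖ ≤ 1) (a0 : a 0 = 0) (F : ℂ → ℂ)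
    (hF : ∀ z : ℂ, 1 < z.re → HasSum (fun n : ℕ => a n * (n : ℂ) ^ (-z)) (F z))
    (y h : ℝ) (hy : 1 ≤ y) (hh : 0 < h) (s : ℂ) (hs0 : 0 ≤ s.re) (hs : s.re < 2) :
    HasSum (fun n : ℕ => a n * (n:ℂ)^(-s) * (((max 0 (y + h - n) - max 0 (y - n)) / h : ℝ) : ℂ))
      ((2 * (Real.pi:ℂ))⁻¹ * ∫ v : ℝ, F (s + (((2 - s.re : ℝ) : ℂ) + v * I)) * Kern y h (((2 - s.re : ℝ) : ℂ) + v * I)) := by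
  set c : ℝ := 2 - s.re with hc
  have hc0 : 0 < c := by linarith
  have hK := kern_int c y h hc0 (by linarith) hy hh
  set G : ℕ → ℝ → ℂ := fun n v => a n * (n:ℂ)^(-(s + ((c:ℂ) + v * I))) * Kern y h ((c:ℂ) + v * I) with hG
  have hre : ∀ v : ℝ, (s + ((c:ℂ) + v * I)).re = 2 := by intro v; simp [hc]
  have hnorm : ∀ n v, ‖G n v‖ ≤ (1 / (n:ℝ)^(2:ℝ)) * ‖Kern y h ((c:ℂ) + v * I)‖ := by
    intro n v
    rcases Nat.eq_zero_or_pos n with rfl | hn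
    · simp [hG, a0]
    simp only [hG]
    rw [norm_mul, norm_mul, norm_natCast_cpow_of_pos hn, neg_re, hre, Real.rpow_neg (by positivity), one_div]
    have := ha n
    refine mul_le_mul_of_nonneg_right ?_ (norm_nonneg _)
    have h2 : 0 ≤ ((n:ℝ)^(2:ℝ))⁻¹ := by positivity
    nlinarith
  have hGint : ∀ n, MeasureTheory.Integrable (G n) := by
    intro n
    rcases Nat.eq_zero_or_pos n with rfl | hn
    · have : G 0 = fun _ => 0 := by ext v; simp [hG, a0]
      rw [this]; exact MeasureTheory.integrable_zero _ _ _
    refine (hK.norm.const_mul (1 / (n:ℝ)^(2:ℝ))).mono' ?_ (Filter.Eventually.of_forall (hnorm n))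
    refine MeasureTheory.AEStronglyMeasurable.mul ?_ hK.aestronglyMeasurable
    refine Continuous.aestronglyMeasurable ?_
    refine continuous_const.mul (Continuous.const_cpow (by fun_prop) (Or.inl ?_))
    exact_mod_cast hn.ne'
  have hsum : Summable (fun n => ∫ v, ‖G n v‖) := by
    refine Summable.of_nonneg_of_le (fun n => MeasureTheory.integral_nonneg (fun v => norm_nonneg _))
      (fun n => MeasureTheory.integral_mono (hGint n).norm (hK.norm.const_mul _) (hnorm n)) ?_
    simp_rw [MeasureTheory.integral_const_mul]
    refine Summable.mul_right _ ?_
    exact Real.summable_one_div_nat_rpow.2 (by norm_num)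
  have hmain := MeasureTheory.hasSum_integral_of_summable_integral_norm hGint hsum
  have e1 : ∀ v, ∑' n, G n v = F (s + ((c:ℂ) + v * I)) * Kern y h ((c:ℂ) + v * I) := by
    intro v
    exact ((hF _ (by rw [hre]; norm_num)).mul_right _).tsum_eq
  simp_rw [e1] at hmain
  have e2 : ∀ n, ∫ v, G n v = 2 * Real.pi * (a n * (n:ℂ)^(-s) * (((max 0 (y + h - n) - max 0 (y - n)) / h : ℝ) : ℂ)) := by
    intro n
    rcases Nat.eq_zero_or_pos n with rfl | hn
    · simp [hG, a0]
    have hnc : (n:ℂ) ≠ 0 := by exact_mod_cast hn.ne'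
    have : G n = fun v : ℝ => (a n * (n:ℂ)^(-s)) * (((n:ℝ):ℂ)^(-((c:ℂ) + v * I)) * Kern y h ((c:ℂ) + v * I)) := by
      ext v
      simp only [hG]
      rw [neg_add, cpow_add _ _ hnc]
      push_cast; ring
    rw [this, MeasureTheory.integral_const_mul, perronK c y h n hc0 (by linarith) hh (by exact_mod_cast hn)]
    ring
  simp_rw [e2] at hmain
  have h3 := hmain.mul_left ((2 * (Real.pi:ℂ))⁻¹)
  have hpi : (2 * (Real.pi:ℂ)) ≠ 0 := by simp [Real.pi_ne_zero]
  simpa only [inv_mul_cancel_left₀ hpi] using h3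


lemma F_diff_bound (ε C0 Q : ℝ) (hε : 0 < ε) (hC0 : 0 < C0) (hQ : 1 ≤ Q) (F : ℂ → ℂ)
    (hb : ∀ z : ℂ, 1/2 + ε/2 ≤ z.re → z.re ≤ 2 → ‖F z‖ ≤ C0 * Real.log (Q * (|z.im| + 3)))
    (s w : ℂ) (hs1 : 1/2 + ε/2 ≤ s.re) (hs2 : s.re ≤ 2) (hw1 : 1/2 + ε/2 ≤ (s+w).re)
    (hw2 : (s+w).re ≤ 2) :
    ‖F (s + w) - F s‖ ≤ C0 * (2 + 4/ε) * Real.log (Q * (|s.im| + 3)) * (1 + |w.im|)^(ε/4) := by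
  have hv := abs_nonneg w.im
  have ht := abs_nonneg s.im
  set L := Real.log (Q * (|s.im| + 3)) with hL
  have hL1 : 1 ≤ L := by
    rw [hL, Real.le_log_iff_exp_le (by positivity)]
    have := Real.exp_one_lt_d9
    nlinarith
  have hP1 : 1 ≤ (1 + |w.im|)^(ε/4) := Real.one_le_rpow (by linarith) (by positivity)
  have h1 := hb s hs1 hs2
  have h2 := hb (s+w) hw1 hw2
  have h3 : Real.log (Q * (|(s+w).im| + 3)) ≤ L + (1 + |w.im|)^(ε/4) / (ε/4) := by
    calc Real.log (Q * (|(s+w).im| + 3)) ≤ Real.log ((Q * (|s.im| + 3)) * (1 + |w.im|)) := by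
          apply Real.log_le_log (by positivity)
          have := abs_add_le s.im w.im
          rw [add_im, mul_assoc]
          gcongr
          nlinarith
      _ = L + Real.log (1 + |w.im|) := by rw [Real.log_mul (by positivity) (by positivity)]
      _ ≤ _ := by
          gcongr
          exact Real.log_le_rpow_div (by linarith) (by positivity)
  set P := (1 + |w.im|)^(ε/4) with hP
  have h4 : P / (ε/4) = 4/ε * P := by field_simp
  have h5 : 0 < 4/ε := by positivity
  calc ‖F (s + w) - F s‖ ≤ C0 * (L + 4/ε * P) + C0 * L := by
        refine (norm_sub_le _ _).trans (add_le_add (h2.trans ?_) h1)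
        rw [← h4]; gcongr
    _ = C0 * (2 * L + 4/ε * P) := by ring
    _ ≤ C0 * (2 * (L * P) + 4/ε * (L * P)) := by
        gcongr
        · nlinarith
        · nlinarith
    _ = _ := by ring

lemma core_int (ε C0 : ℝ) (hε : 0 < ε) (hε' : ε ≤ 1/2) (hC0 : 0 < C0) :
    ∃ C1 > 0, ∀ (F : ℂ → ℂ) (Q : ℝ), 1 ≤ Q →
      DifferentiableOn ℂ F {z | 1/2 + ε/4 < z.re} →
      (∀ z : ℂ, 1/2 + ε/2 ≤ z.re → z.re ≤ 2 → ‖F z‖ ≤ C0 * Real.log (Q * (|z.im| + 3))) →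
      ∀ (y : ℝ), 2 ≤ y → ∀ s : ℂ, 1/2 + ε ≤ s.re → s.re ≤ 3/2 →
      MeasureTheory.Integrable (fun v : ℝ => (F (s + (((2 - s.re : ℝ) : ℂ) + v * I)) - F s) *
        Kern y (√y) (((2 - s.re : ℝ) : ℂ) + v * I)) ∧
      ‖(∫ v : ℝ, (F (s + (((2 - s.re : ℝ) : ℂ) + v * I)) - F s) *
        Kern y (√y) (((2 - s.re : ℝ) : ℂ) + v * I))‖ ≤
        C1 * y ^ (-(ε/4)) * Real.log (Q * (|s.im| + 3)) := by
  have hJ := integrable_decay (1 + ε/4) (by linarith)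
  refine ⟨C0 * (2 + 4/ε) * (4 * (4/ε)^2) * ((∫ v : ℝ, (1 + |v|)^(-(1 + ε/4))) + 1), ?_, ?_⟩
  · have : 0 ≤ ∫ v : ℝ, (1 + |v|)^(-(1 + ε/4)) :=
      MeasureTheory.integral_nonneg (fun v => by positivity)
    positivity
  intro F Q hQ hd hb y hy s hs1 hs2
  set h := √y with hh
  have hy0 : 0 < y := by linarith
  have hhp : 0 < h := Real.sqrt_pos.2 hy0
  have hhy : h ≤ y := by
    rw [hh]; apply Real.sqrt_le_iff.2; constructor <;> nlinarith
  set L := Real.log (Q * (|s.im| + 3)) with hL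
  have hL0 : 0 ≤ L := by
    rw [hL]; apply Real.log_nonneg
    have := abs_nonneg s.im
    nlinarith
  set a : ℝ := 1/2 + ε/2 - s.re with ha
  set b : ℝ := 2 - s.re with hbb
  set f : ℂ → ℂ := fun w => dslope F s (s + w) *
    ((((y + h : ℝ) : ℂ) ^ (w + 1) - (y : ℂ) ^ (w + 1)) / (h * (w + 1))) with hf
  have hfe : ∀ w : ℂ, w ≠ 0 → f w = (F (s + w) - F s) * Kern y h w := by
    intro w hw
    simp only [hf]
    rw [dslope_of_ne _ (by simpa using hw), slope_def_module, Kern]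
    simp only [add_sub_cancel_left, smul_eq_mul]
    have hhc : (h:ℂ) ≠ 0 := by exact_mod_cast hhp.ne'
    by_cases h1 : w + 1 = 0
    · simp [h1]
    field_simp
  have hFd : ∀ w : ℂ, a ≤ w.re → w.re ≤ b →
      ‖F (s + w) - F s‖ ≤ C0 * (2 + 4/ε) * L * (1 + |w.im|)^(ε/4) := by
    intro w h1 h2
    apply F_diff_bound ε C0 Q hε hC0 hQ F hb s w (by linarith) (by linarith)
    · rw [add_re]; linarith
    · rw [add_re]; linarith
  have hcrude : ∀ (w : ℂ) (m : ℝ), 0 < m → a ≤ w.re → w.re ≤ b → w ≠ 0 →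
      m / 2 * (1 + |w.im|) ≤ ‖w‖ → m / 2 * (1 + |w.im|) ≤ ‖w + 1‖ →
      ‖f w‖ ≤ (C0 * (2 + 4/ε) * L * ((2 * (y + h) ^ (3:ℝ) / h) * (2/m)^2)) * (1 + |w.im|)^(-(2 - ε/4)) := by
    intro w m hm h1 h2 h0 h3 h4
    have hv : 0 < 1 + |w.im| := by positivity
    rw [hfe w h0, norm_mul]
    calc _ ≤ (C0 * (2 + 4/ε) * L * (1 + |w.im|)^(ε/4)) * ((2 * (y + h) ^ (3:ℝ) / h) * ((2/m)^2 * (1 + |w.im|)^(-(2:ℝ)))) := by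
          refine mul_le_mul (hFd w h1 h2) ?_ (norm_nonneg _) (by positivity)
          refine (kern_crude y h (by linarith) hhp w (by linarith)).trans ?_
          rw [div_eq_mul_one_div]
          gcongr
          exact inv_prod_bound' w m hm h3 h4
      _ = _ := by
          rw [show (-(2 - ε/4)) = ε/4 + (-(2:ℝ)) by ring, Real.rpow_add hv]
          ring
  have hdf : DifferentiableOn ℂ f {z | a ≤ z.re ∧ z.re ≤ b} := by
    have hU : IsOpen {z : ℂ | 1/2 + ε/4 < z.re} := isOpen_lt continuous_const continuous_re
    have hsU : {z : ℂ | 1/2 + ε/4 < z.re} ∈ nhds s := hU.mem_nhds (by simp only [Set.mem_ofPred_eq]; linarith)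
    have hds := (Complex.differentiableOn_dslope hsU).2 hd
    have hhc : (h:ℂ) ≠ 0 := by exact_mod_cast hhp.ne'
    refine DifferentiableOn.mul ?_ ?_
    · refine hds.comp (f := fun w => s + w) (by fun_prop) ?_
      rintro w ⟨h1, h2⟩
      simp only [Set.mem_ofPred_eq, add_re]; linarith
    · intro w hw
      have hw1 : w + 1 ≠ 0 := by
        intro h; have := congrArg Complex.re h; simp at this; have := hw.1; linarith
      have e1 : ((y + h : ℝ) : ℂ) ≠ 0 := by
        have : y + h ≠ 0 := by positivity
        exact_mod_cast this
      have e2 : (y : ℂ) ≠ 0 := by exact_mod_cast hy0.ne'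
      refine DifferentiableAt.differentiableWithinAt ?_
      refine DifferentiableAt.div ?_ (by fun_prop) (mul_ne_zero hhc hw1)
      refine DifferentiableAt.sub ?_ ?_
      · exact DifferentiableAt.const_cpow (by fun_prop) (Or.inl e1)
      · exact DifferentiableAt.const_cpow (by fun_prop) (Or.inl e2)
  have hline : ∀ c : ℝ, a ≤ c → c ≤ b → Continuous (fun v : ℝ => f (c + v * I)) := by
    intro c h1 h2
    refine hdf.continuousOn.comp_continuous (f := fun v : ℝ => (c:ℂ) + v * I) (by fun_prop) ?_
    intro v; simp [h1, h2]
  have hint : ∀ c : ℝ, a ≤ c → c ≤ b → ∀ m : ℝ, 0 < m → m ≤ 1 → m ≤ |c| → m ≤ |c + 1| →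
      MeasureTheory.Integrable (fun v : ℝ => f (c + v * I)) := by
    intro c h1 h2 m hm hm1 hmc hmc1
    refine MeasureTheory.Integrable.mono'
      ((integrable_decay (2 - ε/4) (by linarith)).const_mul (C0 * (2 + 4/ε) * L * ((2 * (y + h) ^ (3:ℝ) / h) * (2/m)^2)))
      (hline c h1 h2).aestronglyMeasurable (Filter.Eventually.of_forall fun v => ?_)
    have := hcrude (c + v * I) m hm (by simpa using h1) (by simpa using h2) ?_ ?_ ?_
    · simpa using this
    · intro h0; have := congrArg Complex.re h0; simp at this; rw [this] at hmc; simp at hmc; linarith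
    · exact norm_lower _ m hm hm1 (by simpa using hmc)
    · have := norm_lower (c + v * I + 1) m hm hm1 (by simpa using hmc1)
      simpa using this
  have hab : a ≤ b := by linarith
  have hane : a ≤ -(ε/2) := by linarith
  have ha1 : ε/2 ≤ a + 1 := by linarith
  have hia := hint a le_rfl hab (ε/2) (by linarith) (by linarith)
    (by rw [abs_of_neg (by linarith)]; linarith) (by rw [abs_of_pos (by linarith)]; linarith)
  have hib := hint b hab le_rfl (1/2) (by norm_num) (by norm_num)
    (by rw [abs_of_pos (by linarith)]; linarith) (by rw [abs_of_pos (by linarith)]; linarith)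
  have hshift := contour_shift f a b hab (2 - ε/4)
    (C0 * (2 + 4/ε) * L * ((2 * (y + h) ^ (3:ℝ) / h) * (2/1)^2)) (by linarith) hdf ?_ hia hib
  swap
  · intro z h1 h2 h3
    refine hcrude z 1 one_pos h1 h2 ?_ ?_ ?_
    · rintro rfl; simp at h3; linarith
    · have := abs_im_le_norm z; linarith
    · have := abs_im_le_norm (z+1); simp at this; linarith
  have e0 : (fun v : ℝ => (F (s + ((b : ℂ) + v * I)) - F s) * Kern y h ((b : ℂ) + v * I))
      = fun v : ℝ => f (b + v * I) := by
    ext v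
    rw [hfe]
    intro h0; have := congrArg Complex.re h0; simp at this; linarith
  rw [e0]
  refine ⟨hib, ?_⟩
  rw [← hshift]
  have hbound : ∀ v : ℝ, ‖f (a + v * I)‖ ≤
      (C0 * (2 + 4/ε) * (4 * (4/ε)^2) * y ^ (-(ε/4)) * L) * (1 + |v|)^(-(1 + ε/4)) := by
    intro v
    have hv : 0 < 1 + |v| := by positivity
    set w : ℂ := a + v * I with hw
    have hwre : w.re = a := by simp [hw]
    have hwim : w.im = v := by simp [hw]
    have hw0 : w ≠ 0 := by
      intro h0; have := congrArg Complex.re h0; rw [hwre] at this; simp at this; linarith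
    rw [hfe w hw0, norm_mul]
    have k1 := hFd w (by rw [hwre]) (by rw [hwre]; exact hab)
    have k2 := kern_left y h (ε/2) (by linarith) hhp hhy (by linarith) (by linarith) w
      (by rw [hwre]; linarith) (by rw [hwre]; linarith)
    rw [hwim] at k1
    rw [hwre] at k2
    have n1 : ε/4 * (1 + |v|) ≤ ‖w‖ := by
      have := norm_lower w (ε/2) (by linarith) (by linarith)
        (by rw [hwre, abs_of_neg (by linarith)]; linarith)
      rw [hwim] at this; linarith
    have n2 : ε/4 * (1 + |v|) ≤ ‖w + 1‖ := by
      have := norm_lower (w+1) (ε/2) (by linarith) (by linarith)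
        (by rw [add_re, hwre, one_re, abs_of_pos (by linarith)]; linarith)
      rw [add_im, hwim, one_im, add_zero] at this; linarith
    have k3 : ‖Kern y h w‖ ≤ (4 * (4/ε)^2) * y ^ (-(ε/4)) * (1 + |v|)^(-(1 + ε/2)) := by
      refine k2.trans ?_
      have p1 : y ^ a * (y / h) ^ (ε/2) ≤ y ^ (-(ε/4)) := by
        have : y / h = y ^ (1/2 : ℝ) := by
          rw [hh, Real.div_sqrt, Real.sqrt_eq_rpow]
        rw [this, ← Real.rpow_mul hy0.le, ← Real.rpow_add hy0]
        apply Real.rpow_le_rpow_of_exponent_le (by linarith); linarith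
      have p2 : ‖w‖⁻¹ ≤ (4/ε) * (1 + |v|)^(-(1:ℝ)) := by
        rw [Real.rpow_neg_one]
        calc ‖w‖⁻¹ ≤ (ε/4 * (1 + |v|))⁻¹ := by gcongr
          _ = _ := by rw [mul_inv, inv_div]
      have p3 : ‖w + 1‖ ^ (-(ε/2)) ≤ (4/ε) * (1 + |v|)^(-(ε/2)) := by
        calc ‖w + 1‖ ^ (-(ε/2)) ≤ (ε/4 * (1 + |v|)) ^ (-(ε/2)) :=
              Real.rpow_le_rpow_of_nonpos (by positivity) n2 (by linarith)
          _ = (ε/4)^(-(ε/2)) * (1 + |v|) ^ (-(ε/2)) := by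
              rw [Real.mul_rpow (by positivity) (by positivity)]
          _ ≤ _ := by
              gcongr
              rw [← inv_div ε 4, ← Real.rpow_neg_one (ε/4)]
              apply Real.rpow_le_rpow_of_exponent_ge (by positivity) <;> linarith
      calc 4 * y ^ a * (y / h) ^ (ε/2) * (‖w‖⁻¹ * ‖w + 1‖ ^ (-(ε/2)))
          = 4 * (y ^ a * (y / h) ^ (ε/2)) * (‖w‖⁻¹ * ‖w + 1‖ ^ (-(ε/2))) := by ring
        _ ≤ 4 * (y ^ (-(ε/4))) * ((4/ε) * (1 + |v|)^(-(1:ℝ)) * ((4/ε) * (1 + |v|)^(-(ε/2)))) := by gcongr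
        _ = _ := by
            rw [show -(1 + ε/2) = -(1:ℝ) + -(ε/2) by ring, Real.rpow_add hv]; ring
    calc ‖F (s + w) - F s‖ * ‖Kern y h w‖ ≤ (C0 * (2 + 4/ε) * L * (1 + |v|)^(ε/4)) *
          ((4 * (4/ε)^2) * y ^ (-(ε/4)) * (1 + |v|)^(-(1 + ε/2))) :=
          mul_le_mul k1 k3 (norm_nonneg _) (by positivity)
      _ = _ := by
          rw [show -(1 + ε/4) = ε/4 + -(1 + ε/2) by ring, Real.rpow_add hv]; ring
  calc ‖∫ v : ℝ, f (a + v * I)‖ ≤ ∫ v : ℝ, (C0 * (2 + 4/ε) * (4 * (4/ε)^2) * y ^ (-(ε/4)) * L) * (1 + |v|)^(-(1 + ε/4)) :=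
        MeasureTheory.norm_integral_le_of_norm_le (hJ.const_mul _) (Filter.Eventually.of_forall hbound)
    _ = (C0 * (2 + 4/ε) * (4 * (4/ε)^2) * y ^ (-(ε/4)) * L) * ∫ v : ℝ, (1 + |v|)^(-(1 + ε/4)) :=
        MeasureTheory.integral_const_mul _ _
    _ ≤ (C0 * (2 + 4/ε) * (4 * (4/ε)^2) * y ^ (-(ε/4)) * L) * ((∫ v : ℝ, (1 + |v|)^(-(1 + ε/4))) + 1) := by
        gcongr; linarith
    _ = _ := by ring


lemma core (ε C0 : ℝ) (hε : 0 < ε) (hε' : ε ≤ 1/2) (hC0 : 0 < C0) :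
    ∃ C1 > 0, ∀ (a : ℕ → ℂ) (F : ℂ → ℂ) (Q : ℝ), 1 ≤ Q → (∀ n, ‖a n‖ ≤ 1) → a 0 = 0 →
      (∀ z : ℂ, 1 < z.re → HasSum (fun n : ℕ => a n * (n : ℂ) ^ (-z)) (F z)) →
      DifferentiableOn ℂ F {z | 1/2 + ε/4 < z.re} →
      (∀ z : ℂ, 1/2 + ε/2 ≤ z.re → z.re ≤ 2 → ‖F z‖ ≤ C0 * Real.log (Q * (|z.im| + 3))) →
      ∀ (y : ℝ), 2 ≤ y → ∀ s : ℂ, 1/2 + ε ≤ s.re → s.re ≤ 3/2 →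
      ‖(∑ n ∈ Finset.Iic ⌊y⌋₊, a n * (n:ℂ)^(-s)) - F s‖ ≤
        C1 * y ^ (-(ε/4)) * Real.log (Q * (|s.im| + 3)) + 2 := by
  obtain ⟨C1, hC1, H⟩ := core_int ε C0 hε hε' hC0
  refine ⟨C1, hC1, ?_⟩
  intro a F Q hQ ha a0 hF hd hb y hy s hs1 hs2
  obtain ⟨hI, hB⟩ := H F Q hQ hd hb y hy s hs1 hs2
  have hy0 : 0 < y := by linarith
  have hsq : √y * √y = y := Real.mul_self_sqrt hy0.le
  set h := √y with hh
  have hhp : 0 < h := Real.sqrt_pos.2 hy0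
  have hS := smooth_sum a ha a0 F hF y h (by linarith) hhp s (by linarith) (by linarith)
  have hK := kern_int (2 - s.re) y h (by linarith) (by linarith) (by linarith) hhp
  have hP := perronK (2 - s.re) y h 1 (by linarith) hy0 hhp one_pos
  have hφ1 : (max 0 (y + h - 1) - max 0 (y - 1)) / h = 1 := by
    rw [max_eq_right (by linarith), max_eq_right (by linarith)]
    field_simp; ring
  rw [hφ1] at hP
  simp only [ofReal_one, one_cpow, one_mul, mul_one] at hP
  set φ : ℕ → ℝ := fun n => (max 0 (y + h - n) - max 0 (y - n)) / h with hφ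
  have hsplit : (∫ v : ℝ, F (s + (((2 - s.re : ℝ) : ℂ) + v * I)) * Kern y h (((2 - s.re : ℝ) : ℂ) + v * I))
      = (∫ v : ℝ, (F (s + (((2 - s.re : ℝ) : ℂ) + v * I)) - F s) * Kern y h (((2 - s.re : ℝ) : ℂ) + v * I))
        + F s * (2 * Real.pi) := by
    rw [← hP, ← MeasureTheory.integral_const_mul, ← MeasureTheory.integral_add hI (hK.const_mul _)]
    congr 1; ext v; ring
  rw [hsplit] at hS
  set J := (∫ v : ℝ, (F (s + (((2 - s.re : ℝ) : ℂ) + v * I)) - F s) * Kern y h (((2 - s.re : ℝ) : ℂ) + v * I)) with hJ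
  have hpi : (2 * (Real.pi:ℂ)) ≠ 0 := by simp [Real.pi_ne_zero]
  have hle : ⌊y⌋₊ ≤ ⌊y + h⌋₊ := Nat.floor_le_floor (by linarith)
  have hfin : ∑ n ∈ Finset.Iic ⌊y + h⌋₊, a n * (n:ℂ)^(-s) * ((φ n : ℝ) : ℂ) = (2 * (Real.pi:ℂ))⁻¹ * J + F s := by
    have h1 : HasSum (fun n : ℕ => a n * (n:ℂ)^(-s) * ((φ n : ℝ) : ℂ)) (∑ n ∈ Finset.Iic ⌊y + h⌋₊, a n * (n:ℂ)^(-s) * ((φ n : ℝ) : ℂ)) := by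
      apply hasSum_sum_of_ne_finset_zero
      intro n hn
      have hn' : y + h < n := by
        rw [Finset.mem_Iic, not_le] at hn
        exact (Nat.floor_lt (by positivity)).1 hn
      have : φ n = 0 := by
        simp only [hφ]
        rw [max_eq_left (by linarith), max_eq_left (by linarith)]; simp
      rw [this]; simp
    rw [h1.unique hS]
    field_simp
  have hdis : Finset.Iic ⌊y + h⌋₊ = Finset.Iic ⌊y⌋₊ ∪ Finset.Ioc ⌊y⌋₊ ⌊y + h⌋₊ := by
    ext n; simp only [Finset.mem_Iic, Finset.mem_union, Finset.mem_Ioc]; omega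
  rw [hdis, Finset.sum_union (by
    rw [Finset.disjoint_left]; intro n; simp only [Finset.mem_Iic, Finset.mem_Ioc]; omega)] at hfin
  have hfirst : ∑ n ∈ Finset.Iic ⌊y⌋₊, a n * (n:ℂ)^(-s) * ((φ n : ℝ) : ℂ) = ∑ n ∈ Finset.Iic ⌊y⌋₊, a n * (n:ℂ)^(-s) := by
    refine Finset.sum_congr rfl fun n hn => ?_
    have hn' : (n:ℝ) ≤ y := (Nat.le_floor_iff hy0.le).1 (Finset.mem_Iic.1 hn)
    have : φ n = 1 := by
      simp only [hφ]
      rw [max_eq_right (by linarith), max_eq_right (by linarith)]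
      field_simp; ring
    rw [this]; simp
  rw [hfirst] at hfin
  have hsecond : ‖∑ n ∈ Finset.Ioc ⌊y⌋₊ ⌊y + h⌋₊, a n * (n:ℂ)^(-s) * ((φ n : ℝ) : ℂ)‖ ≤ 2 := by
    have hterm : ∀ n ∈ Finset.Ioc ⌊y⌋₊ ⌊y + h⌋₊, ‖a n * (n:ℂ)^(-s) * ((φ n : ℝ) : ℂ)‖ ≤ h⁻¹ := by
      intro n hn
      rw [Finset.mem_Ioc] at hn
      have hn1 : y < n := (Nat.floor_lt hy0.le).1 hn.1
      have hn0 : 0 < n := by omega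
      have hφn : ‖((φ n : ℝ) : ℂ)‖ ≤ 1 := by
        rw [Complex.norm_real, Real.norm_eq_abs]
        simp only [hφ]
        rw [max_eq_left (show y - n ≤ 0 by linarith), sub_zero, abs_of_nonneg (by positivity), div_le_one hhp]
        apply max_le <;> linarith
      have hns : ‖(n:ℂ)^(-s)‖ ≤ h⁻¹ := by
        rw [norm_natCast_cpow_of_pos hn0, neg_re, hh, Real.sqrt_eq_rpow, ← Real.rpow_neg hy0.le]
        calc (n:ℝ)^(-s.re) ≤ (n:ℝ)^(-(1/2:ℝ)) := by
              apply Real.rpow_le_rpow_of_exponent_le <;> linarith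
          _ ≤ _ := Real.rpow_le_rpow_of_nonpos hy0 hn1.le (by norm_num)
      rw [norm_mul, norm_mul]
      calc ‖a n‖ * ‖(n:ℂ)^(-s)‖ * ‖((φ n : ℝ) : ℂ)‖ ≤ 1 * h⁻¹ * 1 := by
            gcongr; exact ha n
        _ = _ := by ring
    refine (norm_sum_le_of_le _ hterm).trans ?_
    rw [Finset.sum_const, Nat.card_Ioc, nsmul_eq_mul, Nat.cast_sub hle]
    have f1 := Nat.floor_le (show 0 ≤ y + h by positivity)
    have f2 := Nat.lt_floor_add_one y
    have h1 : 1 ≤ h := by rw [hh]; apply Real.one_le_sqrt.2; linarith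
    rw [← div_eq_mul_inv, div_le_iff₀ hhp]
    linarith
  have hJ2 : ‖(2 * (Real.pi:ℂ))⁻¹ * J‖ ≤ ‖J‖ := by
    rw [norm_mul, norm_inv, norm_mul, Complex.norm_real, Real.norm_eq_abs, abs_of_pos Real.pi_pos]
    have := Real.pi_gt_three
    apply mul_le_of_le_one_left (norm_nonneg _)
    apply inv_le_one_of_one_le₀
    simp; linarith
  have hfin' : (∑ n ∈ Finset.Iic ⌊y⌋₊, a n * (n:ℂ)^(-s)) - F s = (2 * (Real.pi:ℂ))⁻¹ * J -
      ∑ n ∈ Finset.Ioc ⌊y⌋₊ ⌊y + h⌋₊, a n * (n:ℂ)^(-s) * ((φ n : ℝ) : ℂ) := by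
    linear_combination hfin
  rw [hfin']
  exact (norm_sub_le _ _).trans (add_le_add (hJ2.trans hB) hsecond)


lemma sum_bound (hGRH : GRH) (ε : ℝ) (hε : 0 < ε) (hε' : ε ≤ 1/2) :
    ∃ K > 0, ∀ (q : ℕ) (_ : NeZero q) (χ : DirichletCharacter ℂ q), 1 < q → χ ≠ 1 →
      ∀ y : ℝ, 2 ≤ y → ∀ s : ℂ, 1/2 + ε ≤ s.re → s.re ≤ 3/2 →
      ‖∑ p ∈ (Finset.Iic ⌊y⌋₊).filter Nat.Prime, χ (p : ZMod q) * (p : ℂ) ^ (-s)‖ ≤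
        ε * Real.log (q * (|s.im| + 3)) + K := by
  obtain ⟨C0, hC0, HF⟩ := exists_F hGRH ε hε hε'
  obtain ⟨C1, hC1, H⟩ := core ε C0 hε hε' hC0
  obtain ⟨Y, hY2, hYs⟩ : ∃ Y : ℝ, 2 ≤ Y ∧ C1 * Y ^ (-(ε/4)) ≤ ε/2 := by
    have h1 : Filter.Tendsto (fun Y : ℝ => C1 * Y ^ (-(ε/4))) Filter.atTop (nhds (C1 * 0)) :=
      (tendsto_rpow_neg_atTop (by positivity)).const_mul C1
    rw [mul_zero] at h1
    obtain ⟨Y, h2, h3⟩ := ((Filter.eventually_ge_atTop (2:ℝ)).and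
      (h1.eventually_le_const (show (0:ℝ) < ε/2 by positivity))).exists
    exact ⟨Y, h2, h3⟩
  refine ⟨Y + 5, by linarith, ?_⟩
  intro q _ χ hq hχ y hy s hs1 hs2
  obtain ⟨F, hFd, hFs, hFb⟩ := HF q ‹_› χ hq hχ
  have hq1 : (1:ℝ) ≤ q := by exact_mod_cast hq.le
  set a : ℕ → ℂ := fun n => if n.Prime then χ (n : ZMod q) else 0 with ha
  have ha1 : ∀ n, ‖a n‖ ≤ 1 := by
    intro n; simp only [ha]; split_ifs
    · exact χ.norm_le_one _
    · simp
  have ha0 : a 0 = 0 := by simp [ha, Nat.not_prime_zero]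
  have hsumF : ∀ z : ℂ, 1 < z.re → HasSum (fun n : ℕ => a n * (n : ℂ) ^ (-z)) (F z) := by
    intro z hz
    have hs : Summable (fun p : Nat.Primes => χ ((p : ℕ) : ZMod q) * ((p : ℕ) : ℂ) ^ (-z)) :=
      Summable.of_norm_bounded (summable_primes_rpow z.re hz)
        (fun p => factor_norm_le χ p p.2.two_le z)
    have h1 := hs.hasSum
    rw [← hFs z hz] at h1
    have h2 := (hasSum_subtype_iff_indicator (s := {n : ℕ | n.Prime})
      (f := fun n : ℕ => χ (n : ZMod q) * (n : ℂ) ^ (-z)) (a := F z)).1 h1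
    convert h2 using 1
    ext n
    by_cases hn : n.Prime <;> simp [ha, Set.indicator, hn]
  have hR : ∀ y : ℝ, ∑ n ∈ Finset.Iic ⌊y⌋₊, a n * (n:ℂ)^(-s) =
      ∑ p ∈ (Finset.Iic ⌊y⌋₊).filter Nat.Prime, χ (p : ZMod q) * (p : ℂ) ^ (-s) := by
    intro y
    rw [Finset.sum_filter]
    refine Finset.sum_congr rfl fun n _ => ?_
    simp only [ha]; split_ifs <;> simp
  rw [← hR]
  have hL0 : 0 ≤ Real.log (q * (|s.im| + 3)) := by
    apply Real.log_nonneg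
    have := abs_nonneg s.im
    nlinarith
  have htriv : ∀ y : ℝ, 2 ≤ y → ‖∑ n ∈ Finset.Iic ⌊y⌋₊, a n * (n:ℂ)^(-s)‖ ≤ y + 1 := by
    intro y hy
    have : ∀ n ∈ Finset.Iic ⌊y⌋₊, ‖a n * (n:ℂ)^(-s)‖ ≤ 1 := by
      intro n _
      rcases Nat.eq_zero_or_pos n with rfl | hn
      · simp [ha0]
      rw [norm_mul, norm_natCast_cpow_of_pos hn]
      have h1 : (n:ℝ)^(-s).re ≤ 1 :=
        Real.rpow_le_one_of_one_le_of_nonpos (by exact_mod_cast hn) (by rw [neg_re]; linarith)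
      exact mul_le_one₀ (ha1 n) (by positivity) h1
    refine (norm_sum_le_of_le _ this).trans ?_
    simp
    exact Nat.floor_le (by linarith)
  rcases le_total y Y with hyY | hyY
  · have := htriv y hy
    have : 0 ≤ ε * Real.log (q * (|s.im| + 3)) := by positivity
    linarith
  · have h1 := H a F q hq1 ha1 ha0 hsumF hFd hFb y hy s hs1 hs2
    have h2 := H a F q hq1 ha1 ha0 hsumF hFd hFb Y hY2 s hs1 hs2
    have h3 := htriv Y hY2
    have h4 : y ^ (-(ε/4)) ≤ Y ^ (-(ε/4)) :=
      Real.rpow_le_rpow_of_nonpos (by linarith) hyY (by linarith)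
    set L := Real.log (q * (|s.im| + 3))
    set Ry := ∑ n ∈ Finset.Iic ⌊y⌋₊, a n * (n:ℂ)^(-s)
    set RY := ∑ n ∈ Finset.Iic ⌊Y⌋₊, a n * (n:ℂ)^(-s)
    have h5 : C1 * y ^ (-(ε/4)) * L ≤ ε/2 * L := by
      gcongr
      exact le_trans (by gcongr) hYs
    have h6 : C1 * Y ^ (-(ε/4)) * L ≤ ε/2 * L := by gcongr
    have h7 : ‖Ry‖ ≤ ‖Ry - F s‖ + ‖RY - F s‖ + ‖RY‖ := by
      calc ‖Ry‖ = ‖(Ry - F s) - (RY - F s) + RY‖ := by congr 1; ring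
        _ ≤ ‖(Ry - F s) - (RY - F s)‖ + ‖RY‖ := norm_add_le _ _
        _ ≤ _ := by gcongr; exact norm_sub_le _ _
    linarith

lemma prod_bound (ε : ℝ) (hε : 0 < ε) :
    ∃ A ≥ 0, ∀ (q : ℕ) (χ : DirichletCharacter ℂ q) (y : ℝ) (s : ℂ), 1/2 + ε ≤ s.re →
      ‖∏ p ∈ (Finset.Iic ⌊y⌋₊).filter Nat.Prime, (1 - χ (p : ZMod q) * (p : ℂ) ^ (-s))⁻¹‖ ≤
      Real.exp (‖∑ p ∈ (Finset.Iic ⌊y⌋₊).filter Nat.Prime, χ (p : ZMod q) * (p : ℂ) ^ (-s)‖ + A) := by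
  have hsum : Summable (fun n : ℕ => 2 * (n:ℝ)^(-(1 + 2*ε))) :=
    (Real.summable_nat_rpow.2 (by linarith)).mul_left 2
  refine ⟨∑' n : ℕ, 2 * (n:ℝ)^(-(1 + 2*ε)), tsum_nonneg (fun n => by positivity), ?_⟩
  intro q χ y s hs
  set S := (Finset.Iic ⌊y⌋₊).filter Nat.Prime with hS
  have hSp : ∀ p ∈ S, 2 ≤ p := fun p hp => (Finset.mem_filter.1 hp).2.two_le
  have h1 : ∏ p ∈ S, (1 - χ (p : ZMod q) * (p : ℂ) ^ (-s))⁻¹ =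
      exp (∑ p ∈ S, -log (1 - χ (p : ZMod q) * (p : ℂ) ^ (-s))) := by
    rw [exp_sum]
    refine Finset.prod_congr rfl fun p hp => ?_
    have h2 := factor_norm_le' χ p (hSp p hp) s (by linarith)
    rw [exp_neg, exp_log]
    intro h0
    have : χ (p : ZMod q) * (p : ℂ) ^ (-s) = 1 := by linear_combination -h0
    rw [this] at h2; norm_num at h2
  rw [h1, norm_exp]
  apply Real.exp_le_exp.2
  refine (re_le_norm _).trans ?_
  have h3 : ∑ p ∈ S, -log (1 - χ (p : ZMod q) * (p : ℂ) ^ (-s)) =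
      ∑ p ∈ S, χ (p : ZMod q) * (p : ℂ) ^ (-s) +
      ∑ p ∈ S, (-log (1 - χ (p : ZMod q) * (p : ℂ) ^ (-s)) - χ (p : ZMod q) * (p : ℂ) ^ (-s)) := by
    rw [← Finset.sum_add_distrib]
    refine Finset.sum_congr rfl fun p _ => by ring
  rw [h3]
  refine (norm_add_le _ _).trans (add_le_add le_rfl ?_)
  refine (norm_sum_le_of_le S (fun p hp => (H_bound χ p (hSp p hp) s (by linarith)).trans
    (show _ ≤ 2 * (p:ℝ)^(-(1 + 2*ε)) from ?_))).trans
    (hsum.sum_le_tsum S (fun n _ => by positivity))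
  have hp1 : (1:ℝ) ≤ p := by exact_mod_cast (by have := hSp p hp; omega : 1 ≤ p)
  gcongr
  linarith

lemma half_bound (hGRH : GRH) (ε : ℝ) (hε : 0 < ε) (hε' : ε ≤ 1/2) :
    ∃ C > 0, ∀ (q : ℕ) (_ : NeZero q) (χ : DirichletCharacter ℂ q), 1 < q →
      χ ≠ 1 → ∀ y : ℝ, 2 ≤ y → ∀ s : ℂ, 1 / 2 + ε ≤ s.re →
      ‖∏ p ∈ (Finset.Iic ⌊y⌋₊).filter Nat.Prime,
          (1 - χ (p : ZMod q) * (p : ℂ) ^ (-s))⁻¹‖ ≤ C * ((q : ℝ) * ‖s‖) ^ ε := by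
  obtain ⟨K, hK, hR⟩ := sum_bound hGRH ε hε hε'
  obtain ⟨A, hA, hP⟩ := prod_bound ε hε
  have hsum : Summable (fun n : ℕ => (n:ℝ)^(-(3/2:ℝ))) :=
    Real.summable_nat_rpow.2 (by norm_num)
  set B := ∑' n : ℕ, (n:ℝ)^(-(3/2:ℝ)) with hB
  have hB0 : 0 ≤ B := tsum_nonneg (fun n => by positivity)
  refine ⟨7 ^ ε * Real.exp (K + A + B), by positivity, ?_⟩
  intro q _ χ hq hχ y hy s hs
  have hq2 : (2:ℝ) ≤ q := by exact_mod_cast hq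
  have hns : 1/2 ≤ ‖s‖ := by
    have := (le_abs_self _).trans (abs_re_le_norm s); linarith
  have h7 : (1:ℝ) ≤ 7 ^ ε := Real.one_le_rpow (by norm_num) hε.le
  have hqs : 1 ≤ (q:ℝ) * ‖s‖ := by nlinarith
  have hqs1 : 1 ≤ ((q:ℝ) * ‖s‖)^ε := Real.one_le_rpow hqs hε.le
  refine (hP q χ y s hs).trans ?_
  rcases le_total s.re (3/2) with h | h
  · have hr := hR q ‹_› χ hq hχ y hy s hs h
    have ht : (q:ℝ) * (|s.im| + 3) ≤ 7 * (q * ‖s‖) := by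
      have := abs_im_le_norm s
      nlinarith
    have hpos : 0 < (q:ℝ) * (|s.im| + 3) := by positivity
    calc _ ≤ Real.exp (ε * Real.log (q * (|s.im| + 3)) + (K + A + B)) := by
          apply Real.exp_le_exp.2; linarith
      _ = (q * (|s.im| + 3)) ^ ε * Real.exp (K + A + B) := by
          rw [Real.exp_add, Real.rpow_def_of_pos hpos, mul_comm ε]
      _ ≤ (7 * (q * ‖s‖)) ^ ε * Real.exp (K + A + B) := by gcongr
      _ = _ := by rw [Real.mul_rpow (by norm_num) (by positivity)]; ring
  · have hr : ‖∑ p ∈ (Finset.Iic ⌊y⌋₊).filter Nat.Prime, χ (p : ZMod q) * (p : ℂ) ^ (-s)‖ ≤ B := by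
      refine (norm_sum_le_of_le _ (fun p hp => ?_)).trans (hsum.sum_le_tsum _ (fun n _ => by positivity))
      have hp2 := (Finset.mem_filter.1 hp).2.two_le
      refine (factor_norm_le χ p hp2 s).trans ?_
      have hp1 : (1:ℝ) ≤ p := by exact_mod_cast (by omega : 1 ≤ p)
      gcongr
    calc _ ≤ Real.exp (K + A + B) := by
          apply Real.exp_le_exp.2; linarith
      _ = 1 * Real.exp (K + A + B) * 1 := by ring
      _ ≤ _ := by gcongr


/-- On GRH, for a primitive character `χ mod q` with `q > 1`, `y ≥ 2` and `Re(s) ≥ 1/2 + ε`: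
the partial Euler product satisfies `|L(s,χ;y)| ≪_ε (q|s|)^ε`. -/
theorem partial_L_bound_GRH (hGRH : GRH) :
    ∀ ε > (0 : ℝ), ∃ C > 0, ∀ (q : ℕ) (_ : NeZero q) (χ : DirichletCharacter ℂ q), 1 < q →
      χ.IsPrimitive → ∀ y : ℝ, 2 ≤ y → ∀ s : ℂ, 1 / 2 + ε ≤ s.re →
      ‖∏ p ∈ (Finset.Iic ⌊y⌋₊).filter Nat.Prime,
          (1 - χ (p : ZMod q) * (p : ℂ) ^ (-s))⁻¹‖ ≤ C * ((q : ℝ) * ‖s‖) ^ ε := by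
  intro ε hε
  have hne : ∀ (q : ℕ) (_ : NeZero q) (χ : DirichletCharacter ℂ q), 1 < q → χ.IsPrimitive → χ ≠ 1 := by
    rintro q _ χ hq hp rfl
    rw [DirichletCharacter.isPrimitive_def, DirichletCharacter.conductor_one] at hp
    omega
  rcases le_total ε (1/2) with h | h
  · obtain ⟨C, hC, H⟩ := half_bound hGRH ε hε h
    exact ⟨C, hC, fun q hq0 χ hq hp => H q hq0 χ hq (hne q hq0 χ hq hp)⟩
  · obtain ⟨C, hC, H⟩ := half_bound hGRH (1/2) (by norm_num) le_rfl
    refine ⟨C, hC, fun q hq0 χ hq hp y hy s hs => ?_⟩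
    refine (H q hq0 χ hq (hne q hq0 χ hq hp) y hy s (by linarith)).trans ?_
    have hq2 : (2:ℝ) ≤ q := by exact_mod_cast hq
    have hns : 1/2 ≤ ‖s‖ := by
      have := (le_abs_self _).trans (abs_re_le_norm s); linarith
    have hqs : 1 ≤ (q:ℝ) * ‖s‖ := by nlinarith
    gcongr
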